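/- Let U and V be domains (open connected sets) in ℂ and ψ : U → V a holomorphic map. Then ψ is a covering map if and only if for every v ∈ V, every simply-connected domain W with v ∈ W that is compactly contained in V, and every u ∈ U with ψ(u) = v, there exists a holomorphic map g : W → U with ψ ∘ g = id on W and g(v) = u. -/

import Mathlib

open Set Filter Topology

/-- Two continuous sections of `f` over a preconnected set, one of which is an open map, coincide
as soon as they agree at one point. -/
lemma eq_of_sections_eq {E X : Type*} [TopologicalSpace E] [T2Space E] [TopologicalSpace X]
    {f : E → X} {W : Set X} [PreconnectedSpace W] {s t : W → E}
    (hs : Continuous s) (ht : Continuous t) (hso : IsOpenMap s)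
    (hfs : ∀ w, f (s w) = w) (hft : ∀ w, f (t w) = w) {w₀ : W} (h : s w₀ = t w₀) : s = t := by
  have hset : {w | s w = t w} = t ⁻¹' range s := by
    ext w
    constructor
    · intro hw
      exact ⟨w, hw⟩
    · rintro ⟨w', hw'⟩
      have : w' = w := Subtype.ext (by rw [← hfs w', hw', hft])
      rwa [this] at hw'
  have hclopen : IsClopen {w | s w = t w} :=
    ⟨isClosed_eq hs ht, hset ▸ hso.isOpen_range.preimage ht⟩
  have huniv := hclopen.eq_univ ⟨w₀, h⟩
  exact funext fun w ↦ (huniv ▸ mem_univ w : w ∈ {w | s w = t w})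

/-- A point is evenly covered by a continuous map `f` if it has a connected open neighborhood `W`
such that every point over `W` lies on the image of a continuous open section of `f` over `W`. -/
lemma IsEvenlyCovered.of_sections {E X : Type*} [TopologicalSpace E] [T2Space E]
    [TopologicalSpace X] {f : E → X} (hf : Continuous f) {W : Set X} (hW : IsOpen W)
    [PreconnectedSpace W] {x : X} (hx : x ∈ W)
    (h : ∀ w : W, ∀ e : E, f e = w →
      ∃ s : W → E, Continuous s ∧ IsOpenMap s ∧ (∀ w, f (s w) = w) ∧ s w = e) :
    IsEvenlyCovered f x (f ⁻¹' {x}) := by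
  choose s hsc hso hfs hsx using fun i : f ⁻¹' {x} ↦ h ⟨x, hx⟩ i i.2
  have hinj {i j : f ⁻¹' {x}} {w w' : W} (hij : s i w = s j w') : w = w' ∧ i = j := by
    obtain rfl : w = w' := Subtype.ext (by rw [← hfs i w, hij, hfs])
    refine ⟨rfl, Subtype.ext ?_⟩
    rw [← hsx i, ← hsx j, eq_of_sections_eq (hsc i) (hsc j) (hso i) (hfs i) (hfs j) hij]
  have hdisc : DiscreteTopology (f ⁻¹' {x}) := by
    rw [discreteTopology_iff_isOpen_singleton]
    intro i
    convert (hso i).isOpen_range.preimage continuous_subtype_val using 1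
    ext j
    simp only [mem_singleton_iff, mem_preimage, mem_range]
    constructor
    · rintro rfl
      exact ⟨_, hsx j⟩
    · rintro ⟨w, hw⟩
      exact (hinj (hw.trans (hsx j).symm)).2.symm
  let Φ : W × f ⁻¹' {x} → f ⁻¹' W := fun p ↦ ⟨s p.2 p.1, by simp [hfs]⟩
  have hΦ : Function.Bijective Φ := by
    constructor
    · rintro ⟨w, i⟩ ⟨w', j⟩ hij
      obtain ⟨rfl, rfl⟩ := hinj (congrArg Subtype.val hij)
      rfl
    · rintro ⟨e, he⟩
      obtain ⟨t, htc, hto, hft, hte⟩ := h ⟨f e, he⟩ e rfl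
      let i : f ⁻¹' {x} := ⟨t ⟨x, hx⟩, hft _⟩
      refine ⟨(⟨f e, he⟩, i), Subtype.ext ?_⟩
      change s i _ = e
      rw [eq_of_sections_eq (hsc i) htc (hso i) (hfs i) hft (hsx i), hte]
  have hΦc : Continuous Φ :=
    (continuous_prod_of_discrete_right.mpr hsc).subtype_mk _
  have hΦo : IsOpenMap Φ := by
    intro O hO
    have : Φ '' O = ⋃ i, Subtype.val ⁻¹' (s i '' ((fun w ↦ (w, i)) ⁻¹' O)) := by
      ext e
      simp only [mem_image, mem_iUnion, mem_preimage, Prod.exists, Φ, Subtype.ext_iff]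
      exact exists_comm
    rw [this]
    exact isOpen_iUnion fun i ↦
      (hso i _ (hO.preimage (by fun_prop))).preimage continuous_subtype_val
  let H := (Equiv.ofBijective Φ hΦ).toHomeomorphOfContinuousOpen hΦc hΦo
  refine ⟨hdisc, W, hx, hW, hW.preimage hf, H.symm, fun e ↦ ?_⟩
  obtain ⟨p, rfl⟩ := H.surjective e
  rw [H.symm_apply_apply]
  exact (hfs p.2 p.1).symm

/-- A continuous right inverse of a holomorphic function is holomorphic. -/
lemma DifferentiableOn.of_continuousOn_rightInverse {U W : Set ℂ} {ψ g : ℂ → ℂ} (hU : IsOpen U)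
    (hW : IsOpen W) (hψ : DifferentiableOn ℂ ψ U) (hg : ContinuousOn g W) (hgU : MapsTo g W U)
    (hψg : ∀ w ∈ W, ψ (g w) = w) : DifferentiableOn ℂ g W := by
  intro w₀ hw₀
  have hWn : ∀ᶠ w in 𝓝 w₀, w ∈ W := hW.mem_nhds hw₀
  have hgc : ContinuousAt g w₀ := hg.continuousAt hWn
  have hUn : U ∈ 𝓝 (g w₀) := hU.mem_nhds (hgU hw₀)
  have hψan : AnalyticAt ℂ ψ (g w₀) := hψ.analyticAt hUn
  have hgp : Tendsto g (𝓝[≠] w₀) (𝓝[≠] (g w₀)) := by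
    refine tendsto_nhdsWithin_iff.mpr ⟨hgc.tendsto.mono_left nhdsWithin_le_nhds, ?_⟩
    filter_upwards [nhdsWithin_le_nhds hWn, self_mem_nhdsWithin] with w hw hne heq
    exact hne (by rw [mem_singleton_iff, ← hψg w hw, heq, hψg w₀ hw₀])
  refine (Complex.analyticAt_of_differentiable_on_punctured_nhds_of_continuousAt ?_
    hgc).differentiableAt.differentiableWithinAt
  rcases hψan.deriv.eventually_eq_zero_or_eventually_ne_zero with hzero | hne
  · obtain ⟨r, hr, hball⟩ := Metric.eventually_nhds_iff_ball.mp (hzero.and hUn)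
    have hconst : ∀ z ∈ Metric.ball (g w₀) r, ψ z = w₀ := fun z hz ↦
      (Metric.isOpen_ball.is_const_of_deriv_eq_zero (convex_ball _ _).isPreconnected
        (hψ.mono fun z hz ↦ (hball z hz).2) (fun z hz ↦ (hball z hz).1) hz
        (Metric.mem_ball_self hr)).trans (hψg w₀ hw₀)
    have hfalse : ∀ᶠ w in 𝓝[≠] w₀, False := by
      filter_upwards [nhdsWithin_le_nhds hWn, self_mem_nhdsWithin,
        nhdsWithin_le_nhds (hgc (Metric.ball_mem_nhds _ hr))] with w hw hne hwb
      exact hne (by rw [mem_singleton_iff, ← hψg w hw, hconst _ hwb])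
    exact hfalse.mono fun _ ↦ False.elim
  · filter_upwards [hgp.eventually hne, nhdsWithin_le_nhds hWn] with w hd hw
    exact (HasDerivAt.of_local_left_inverse (hg.continuousAt (hW.mem_nhds hw))
      (hψ.differentiableAt (hU.mem_nhds (hgU hw))).hasDerivAt hd
      ((hW.eventually_mem hw).mono hψg)).differentiableAt

/-- An injective holomorphic function on a disc maps open subsets of the disc to open sets. -/
lemma DifferentiableOn.isOpen_image_of_injOn_ball {g : ℂ → ℂ} {c : ℂ} {r : ℝ}
    (hg : DifferentiableOn ℂ g (Metric.ball c r)) (hinj : InjOn g (Metric.ball c r))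
    {s : Set ℂ} (hs : s ⊆ Metric.ball c r) (hso : IsOpen s) : IsOpen (g '' s) := by
  rcases (hg.analyticOnNhd Metric.isOpen_ball).is_constant_or_isOpen
    (convex_ball c r).isPreconnected with ⟨a, ha⟩ | h
  · have hsub : (Metric.ball c r).Subsingleton := fun z hz w hw ↦
      hinj hz hw ((ha z hz).trans (ha w hw).symm)
    rcases s.eq_empty_or_nonempty with rfl | ⟨z, hz⟩
    · simp
    · have hz' : s = {z} := (hsub.anti hs).eq_singleton_of_mem hz
      exact absurd (hz' ▸ hso) (not_isOpen_singleton z)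
  · exact h s hs hso


/-- A holomorphic map `ψ : U → V` between domains in `ℂ` is a covering map if and
only if for every `v ∈ V`, every simply-connected domain `W ∋ v` compactly contained
in `V`, and every preimage `u` of `v`, there is a holomorphic inverse branch of `ψ`
on `W` sending `v` to `u`. -/
theorem covering_iff_inverse_branches
    (U V : Set ℂ) (hU : IsOpen U) (hUconn : IsConnected U)
    (hV : IsOpen V) (hVconn : IsConnected V)
    (ψ : ℂ → ℂ) (hψ : DifferentiableOn ℂ ψ U) (hmap : Set.MapsTo ψ U V) :
    IsCoveringMap (Set.MapsTo.restrict ψ U V hmap) ↔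
      ∀ v ∈ V, ∀ W : Set ℂ, IsOpen W → IsConnected W → SimplyConnectedSpace W →
        v ∈ W → closure W ⊆ V → IsCompact (closure W) →
        ∀ u ∈ U, ψ u = v →
          ∃ g : ℂ → ℂ, DifferentiableOn ℂ g W ∧ Set.MapsTo g W U ∧
            (∀ w ∈ W, ψ (g w) = w) ∧ g v = u := by
  constructor
  · intro hcov v hv W hW _ _ hvW hWV _ u hu huv
    have hWV' : W ⊆ V := subset_closure.trans hWV
    have := hW.locallyPathConnectedSpace
    obtain ⟨F, ⟨hFv, hF⟩, -⟩ := hcov.existsUnique_continuousMap_lifts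
      (⟨inclusion hWV', continuous_inclusion hWV'⟩ : C(W, V)) ⟨v, hvW⟩ ⟨u, hu⟩
      (Subtype.ext huv)
    classical
    let g : ℂ → ℂ := fun w ↦ if hw : w ∈ W then F ⟨w, hw⟩ else 0
    have hg (w : W) : g w = F w := dif_pos w.2
    have hgU : MapsTo g W U := fun w hw ↦ by
      rw [hg ⟨w, hw⟩]
      exact (F _).2
    have hψg : ∀ w ∈ W, ψ (g w) = w := fun w hw ↦ by
      rw [hg ⟨w, hw⟩]
      exact congrArg Subtype.val (congrFun hF ⟨w, hw⟩)
    have hgc : ContinuousOn g W := by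
      rw [continuousOn_iff_continuous_domRestrict]
      exact (continuous_subtype_val.comp F.continuous).congr fun w ↦ (hg w).symm
    exact ⟨g, hψ.of_continuousOn_rightInverse hU hW hgc hgU hψg, hgU, hψg,
      (hg ⟨v, hvW⟩).trans (congrArg Subtype.val hFv)⟩
  · intro h x
    obtain ⟨r, hr, hrV⟩ := Metric.nhds_basis_closedBall.mem_iff.mp (hV.mem_nhds x.2)
    set B := Metric.ball (x : ℂ) r
    have hBV : B ⊆ V := Metric.ball_subset_closedBall.trans hrV
    have hxB : (x : ℂ) ∈ B := Metric.mem_ball_self hr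
    have hBc : closure B ⊆ Metric.closedBall (x : ℂ) r := Metric.closure_ball_subset_closedBall
    have hBconn : IsConnected B := Metric.isConnected_ball hr
    have : ContractibleSpace B := (convex_ball _ _).contractibleSpace ⟨_, hxB⟩
    have : PreconnectedSpace (Subtype.val ⁻¹' B : Set V) := by
      rw [← isPreconnected_iff_preconnectedSpace, ← IsInducing.subtypeVal.isPreconnected_image,
        Subtype.image_preimage_coe, inter_eq_right.mpr hBV]
      exact hBconn.isPreconnected
    refine IsEvenlyCovered.of_sections (hψ.continuousOn.mapsToRestrict hmap)
      (Metric.isOpen_ball.preimage continuous_subtype_val) hxB fun w e he ↦ ?_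
    obtain ⟨g, hgd, hgU, hψg, hgw⟩ := h w w.1.2 B Metric.isOpen_ball hBconn inferInstance w.2
      (hBc.trans hrV) ((isCompact_closedBall _ _).of_isClosed_subset isClosed_closure hBc)
      e e.2 (congrArg Subtype.val he)
    have hinj : InjOn g B := fun z hz z' hz' hzz' ↦ by rw [← hψg z hz, hzz', hψg z' hz']
    refine ⟨fun w ↦ ⟨g w, hgU w.2⟩, ?_, fun O hO ↦ ?_, fun w ↦ Subtype.ext (hψg w w.2),
      Subtype.ext hgw⟩
    · exact (hgd.continuousOn.comp_continuous (by fun_prop) fun w ↦ w.2).subtype_mk _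
    · have hO' : IsOpen ((fun w : (Subtype.val ⁻¹' B : Set V) ↦ (w : ℂ)) '' O) := by
        rw [← image_image Subtype.val Subtype.val]
        exact hV.isOpenMap_subtype_val _
          ((Metric.isOpen_ball.preimage continuous_subtype_val).isOpenMap_subtype_val _ hO)
      convert (hgd.isOpen_image_of_injOn_ball hinj (by rintro _ ⟨w, -, rfl⟩; exact w.2)
        hO').preimage continuous_subtype_val using 1
      ext e
      rw [mem_preimage, image_image]
      exact exists_congr fun _ ↦ and_congr_right fun _ ↦ Subtype.ext_iff
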